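/- For every formula φ(x) in Π^x ∪ Σ^x (the union of the two dual hierarchies), the fixed-point equation x ≡ φ(x) has a solution: there exists a formula ψ not containing x such that ψ ≡ φ(ψ) is valid. -/

import Mathlib

mutual
inductive PDLFormula (P V A : Type) : Type
  | var : V → PDLFormula P V A
  | atom : P → PDLFormula P V A
  | natom : P → PDLFormula P V A
  | or : PDLFormula P V A → PDLFormula P V A → PDLFormula P V A
  | and : PDLFormula P V A → PDLFormula P V A → PDLFormula P V A
  | dia : PDLProgram P V A → PDLFormula P V A → PDLFormula P V A
  | box : PDLProgram P V A → PDLFormula P V A → PDLFormula P V A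

inductive PDLProgram (P V A : Type) : Type
  | aprog : A → PDLProgram P V A
  | test : PDLFormula P V A → PDLProgram P V A
  | seq : PDLProgram P V A → PDLProgram P V A → PDLProgram P V A
  | union : PDLProgram P V A → PDLProgram P V A → PDLProgram P V A
  | star : PDLProgram P V A → PDLProgram P V A
end

structure PDLModel (P V A : Type) where
  W : Type
  nonempty : Nonempty W
  R : A → W → W → Prop
  Vp : P → Set W
  Vv : V → Set W

mutual
def PDLModel.Sat {P V A : Type} (M : PDLModel P V A) : PDLFormula P V A → M.W → Prop
  | .var x => fun w => w ∈ M.Vv x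
  | .atom p => fun w => w ∈ M.Vp p
  | .natom p => fun w => w ∉ M.Vp p
  | .or φ ψ => fun w => M.Sat φ w ∨ M.Sat ψ w
  | .and φ ψ => fun w => M.Sat φ w ∧ M.Sat ψ w
  | .dia α φ => fun w => ∃ u, M.Rel α w u ∧ M.Sat φ u
  | .box α φ => fun w => ∀ u, M.Rel α w u → M.Sat φ u

def PDLModel.Rel {P V A : Type} (M : PDLModel P V A) : PDLProgram P V A → M.W → M.W → Prop
  | .aprog a => M.R a
  | .test φ => fun w u => w = u ∧ M.Sat φ w
  | .seq α β => fun w u => ∃ v, M.Rel α w v ∧ M.Rel β v u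
  | .union α β => fun w u => M.Rel α w u ∨ M.Rel β w u
  | .star α => Relation.ReflTransGen (M.Rel α)
end

def PDLFormula.nneg {P V A : Type} : PDLFormula P V A → PDLFormula P V A
  | .var x => .var x
  | .atom p => .natom p
  | .natom p => .atom p
  | .or φ ψ => .and φ.nneg ψ.nneg
  | .and φ ψ => .or φ.nneg ψ.nneg
  | .dia α φ => .box α φ.nneg
  | .box α φ => .dia α φ.nneg

mutual
def PDLFormula.noVar {P V A : Type} : PDLFormula P V A → Prop
  | .var _ => False
  | .atom _ => True
  | .natom _ => True
  | .or φ ψ => φ.noVar ∧ ψ.noVar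
  | .and φ ψ => φ.noVar ∧ ψ.noVar
  | .dia α φ => α.noVar ∧ φ.noVar
  | .box α φ => α.noVar ∧ φ.noVar

def PDLProgram.noVar {P V A : Type} : PDLProgram P V A → Prop
  | .aprog _ => True
  | .test φ => φ.noVar
  | .seq α β => α.noVar ∧ β.noVar
  | .union α β => α.noVar ∧ β.noVar
  | .star α => α.noVar
end

mutual
def PDLFormula.xFree {P V A : Type} (x : V) : PDLFormula P V A → Prop
  | .var y => y ≠ x
  | .atom _ => True
  | .natom _ => True
  | .or φ ψ => φ.xFree x ∧ ψ.xFree x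
  | .and φ ψ => φ.xFree x ∧ ψ.xFree x
  | .dia α φ => α.xFree x ∧ φ.xFree x
  | .box α φ => α.xFree x ∧ φ.xFree x

def PDLProgram.xFree {P V A : Type} (x : V) : PDLProgram P V A → Prop
  | .aprog _ => True
  | .test φ => φ.xFree x
  | .seq α β => α.xFree x ∧ β.xFree x
  | .union α β => α.xFree x ∧ β.xFree x
  | .star α => α.xFree x
end

mutual
def PDLFormula.subst {P V A : Type} [DecidableEq V] (x : V) (ψ : PDLFormula P V A) :
    PDLFormula P V A → PDLFormula P V A
  | .var y => if y = x then ψ else .var y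
  | .atom p => .atom p
  | .natom p => .natom p
  | .or φ χ => .or (PDLFormula.subst x ψ φ) (PDLFormula.subst x ψ χ)
  | .and φ χ => .and (PDLFormula.subst x ψ φ) (PDLFormula.subst x ψ χ)
  | .dia α φ => .dia (PDLProgram.subst x ψ α) (PDLFormula.subst x ψ φ)
  | .box α φ => .box (PDLProgram.subst x ψ α) (PDLFormula.subst x ψ φ)

def PDLProgram.subst {P V A : Type} [DecidableEq V] (x : V) (ψ : PDLFormula P V A) :
    PDLProgram P V A → PDLProgram P V A
  | .aprog a => .aprog a
  | .test φ => .test (PDLFormula.subst x ψ φ)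
  | .seq α β => .seq (PDLProgram.subst x ψ α) (PDLProgram.subst x ψ β)
  | .union α β => .union (PDLProgram.subst x ψ α) (PDLProgram.subst x ψ β)
  | .star α => .star (PDLProgram.subst x ψ α)
end

/-- The hierarchy `Π^x_n`: level `0` consists of `φ ∨ (ψ ∧ x)` with `φ, ψ` variable-free;
odd levels `2n+1` are `[α]φ` with `φ ∈ Π^x_{2n}` and `α` variable-free;
even levels `2n+2` are `φ ∨ (ψ ∧ χ)` with `χ ∈ Π^x_{2n+1}` and `φ, ψ` variable-free. -/
inductive PiLevel {P V A : Type} (x : V) : ℕ → PDLFormula P V A → Prop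
  | base {φ ψ : PDLFormula P V A} (hφ : φ.noVar) (hψ : ψ.noVar) :
      PiLevel x 0 (.or φ (.and ψ (.var x)))
  | odd {n : ℕ} {φ : PDLFormula P V A} {α : PDLProgram P V A}
      (h : PiLevel x (2 * n) φ) (hα : α.noVar) :
      PiLevel x (2 * n + 1) (.box α φ)
  | even {n : ℕ} {χ φ ψ : PDLFormula P V A}
      (h : PiLevel x (2 * n + 1) χ) (hφ : φ.noVar) (hψ : ψ.noVar) :
      PiLevel x (2 * n + 2) (.or φ (.and ψ χ))

mutual
theorem PDLFormula.noVar.xFree {P V A : Type} (x : V) :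
    ∀ {φ : PDLFormula P V A}, φ.noVar → φ.xFree x
  | .var _, h => (h : False).elim
  | .atom _, _ => trivial
  | .natom _, _ => trivial
  | .or _ _, h => ⟨h.1.xFree x, h.2.xFree x⟩
  | .and _ _, h => ⟨h.1.xFree x, h.2.xFree x⟩
  | .dia _ _, h => ⟨h.1.xFree x, h.2.xFree x⟩
  | .box _ _, h => ⟨h.1.xFree x, h.2.xFree x⟩

theorem PDLProgram.noVar.xFree {P V A : Type} (x : V) :
    ∀ {α : PDLProgram P V A}, α.noVar → α.xFree x
  | .aprog _, _ => trivial
  | .test φ, h => PDLFormula.noVar.xFree (φ := φ) x h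
  | .seq _ _, h => ⟨h.1.xFree x, h.2.xFree x⟩
  | .union _ _, h => ⟨h.1.xFree x, h.2.xFree x⟩
  | .star α, h => PDLProgram.noVar.xFree (α := α) x h
end

mutual
theorem PDLFormula.xFree.subst_eq {P V A : Type} [DecidableEq V] {x : V} (ψ : PDLFormula P V A) :
    ∀ {φ : PDLFormula P V A}, φ.xFree x → PDLFormula.subst x ψ φ = φ
  | .var _, h => if_neg h
  | .atom _, _ => rfl
  | .natom _, _ => rfl
  | .or _ _, h => congrArg₂ PDLFormula.or (h.1.subst_eq ψ) (h.2.subst_eq ψ)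
  | .and _ _, h => congrArg₂ PDLFormula.and (h.1.subst_eq ψ) (h.2.subst_eq ψ)
  | .dia _ _, h => congrArg₂ PDLFormula.dia (h.1.subst_eq ψ) (h.2.subst_eq ψ)
  | .box _ _, h => congrArg₂ PDLFormula.box (h.1.subst_eq ψ) (h.2.subst_eq ψ)

theorem PDLProgram.xFree.subst_eq {P V A : Type} [DecidableEq V] {x : V} (ψ : PDLFormula P V A) :
    ∀ {α : PDLProgram P V A}, α.xFree x → PDLProgram.subst x ψ α = α
  | .aprog _, _ => rfl
  | .test φ, h => congrArg PDLProgram.test (PDLFormula.xFree.subst_eq (φ := φ) ψ h)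
  | .seq _ _, h => congrArg₂ PDLProgram.seq (h.1.subst_eq ψ) (h.2.subst_eq ψ)
  | .union _ _, h => congrArg₂ PDLProgram.union (h.1.subst_eq ψ) (h.2.subst_eq ψ)
  | .star α, h => congrArg PDLProgram.star (PDLProgram.xFree.subst_eq (α := α) ψ h)
end

theorem PDLFormula.noVar.nneg {P V A : Type} :
    ∀ {φ : PDLFormula P V A}, φ.noVar → φ.nneg.noVar
  | .var _, h => (h : False).elim
  | .atom _, _ => trivial
  | .natom _, _ => trivial
  | .or _ _, h => ⟨h.1.nneg, h.2.nneg⟩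
  | .and _ _, h => ⟨h.1.nneg, h.2.nneg⟩
  | .dia _ _, h => ⟨h.1, h.2.nneg⟩
  | .box _ _, h => ⟨h.1, h.2.nneg⟩

theorem PDLModel.sat_nneg {P V A : Type} (M : PDLModel P V A) :
    ∀ {φ : PDLFormula P V A}, φ.noVar → ∀ w, M.Sat φ.nneg w ↔ ¬ M.Sat φ w
  | .var _, h, _ => (h : False).elim
  | .atom _, _, _ => Iff.rfl
  | .natom _, _, _ => not_not.symm
  | .or _ _, h, w => by
    simp only [PDLFormula.nneg, PDLModel.Sat, M.sat_nneg h.1, M.sat_nneg h.2, not_or]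
  | .and _ _, h, w => by
    simp only [PDLFormula.nneg, PDLModel.Sat, M.sat_nneg h.1, M.sat_nneg h.2, not_and_or]
  | .dia _ _, h, w => by
    simp only [PDLFormula.nneg, PDLModel.Sat, M.sat_nneg h.2, not_exists, not_and]
  | .box _ _, h, w => by
    simp only [PDLFormula.nneg, PDLModel.Sat, M.sat_nneg h.2, not_forall, exists_prop]

/-- Substituting into a formula of the hierarchy commutes with negation: since `¬̄x = x`, the
negation of `χ(ψ)` is `(¬̄χ)(¬̄ψ)`. -/
theorem PiLevel.nneg_subst {P V A : Type} [DecidableEq V] {x : V} {n : ℕ} {χ : PDLFormula P V A}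
    (h : PiLevel x n χ) (ψ : PDLFormula P V A) :
    PDLFormula.subst x ψ.nneg χ.nneg = (PDLFormula.subst x ψ χ).nneg := by
  induction h with
  | base hφ hψ =>
    simp [PDLFormula.nneg, PDLFormula.subst, (hφ.xFree x).subst_eq, (hψ.xFree x).subst_eq,
      (hφ.nneg.xFree x).subst_eq, (hψ.nneg.xFree x).subst_eq]
  | odd _ hα ih =>
    simp [PDLFormula.nneg, PDLFormula.subst, (hα.xFree x).subst_eq, ih]
  | even _ hφ hψ ih =>
    simp [PDLFormula.nneg, PDLFormula.subst, (hφ.xFree x).subst_eq, (hψ.xFree x).subst_eq,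
      (hφ.nneg.xFree x).subst_eq, (hψ.nneg.xFree x).subst_eq, ih]

theorem PiLevel.noVar_subst {P V A : Type} [DecidableEq V] {x : V} {n : ℕ} {χ : PDLFormula P V A}
    (h : PiLevel x n χ) {ψ : PDLFormula P V A} (hψ : ψ.noVar) :
    (PDLFormula.subst x ψ χ).noVar := by
  induction h with
  | base h₁ h₂ =>
    simp [PDLFormula.noVar, PDLFormula.subst, (h₁.xFree x).subst_eq, (h₂.xFree x).subst_eq, *]
  | odd _ hα ih =>
    simp [PDLFormula.noVar, PDLFormula.subst, (hα.xFree x).subst_eq, *]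
  | even _ h₁ h₂ ih =>
    simp [PDLFormula.noVar, PDLFormula.subst, (h₁.xFree x).subst_eq, (h₂.xFree x).subst_eq, *]

/-- Every formula of the hierarchy is equivalent to `ξ ∧ [β]x` with `ξ` and `β` variable-free. -/
theorem PiLevel.exists_and_box_normalForm {P V A : Type} [DecidableEq V] {x : V} {n : ℕ}
    {χ : PDLFormula P V A} (h : PiLevel x n χ) :
    ∃ (ξ : PDLFormula P V A) (β : PDLProgram P V A), ξ.noVar ∧ β.noVar ∧
      ∀ (ψ : PDLFormula P V A) (M : PDLModel P V A) (w : M.W),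
        M.Sat (PDLFormula.subst x ψ χ) w ↔ M.Sat (.and ξ (.box β ψ)) w := by
  induction h with
  | @base φ ψ hφ hψ =>
    refine ⟨.or φ ψ, .test φ.nneg, ⟨hφ, hψ⟩, hφ.nneg, fun θ M w => ?_⟩
    simp only [PDLFormula.subst, (hφ.xFree x).subst_eq, (hψ.xFree x).subst_eq, if_true,
      PDLModel.Sat, PDLModel.Rel, M.sat_nneg hφ, and_imp, forall_eq']
    tauto
  | @odd _ _ α _ hα ih =>
    obtain ⟨ξ, β, hξ, hβ, hs⟩ := ih
    refine ⟨.box α ξ, .seq α β, ⟨hα, hξ⟩, ⟨hα, hβ⟩, fun θ M w => ?_⟩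
    simp only [PDLFormula.subst, (hα.xFree x).subst_eq, PDLModel.Sat, PDLModel.Rel, hs]
    grind
  | @even _ _ φ ψ _ hφ hψ ih =>
    obtain ⟨ξ, β, hξ, hβ, hs⟩ := ih
    refine ⟨.or φ (.and ψ ξ), .seq (.test φ.nneg) β, ⟨hφ, hψ, hξ⟩, ⟨hφ.nneg, hβ⟩,
      fun θ M w => ?_⟩
    simp only [PDLFormula.subst, (hφ.xFree x).subst_eq, (hψ.xFree x).subst_eq,
      PDLModel.Sat, PDLModel.Rel, hs, M.sat_nneg hφ]
    grind

/-- `[β*]ξ` is a fixed point of `x ↦ ξ ∧ [β]x`. -/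
theorem PDLModel.sat_box_star {P V A : Type} (M : PDLModel P V A) (β : PDLProgram P V A)
    (ξ : PDLFormula P V A) (w : M.W) :
    M.Sat (.box (.star β) ξ) w ↔ M.Sat (.and ξ (.box β (.box (.star β) ξ))) w := by
  simp only [PDLModel.Sat, PDLModel.Rel]
  refine ⟨fun h => ⟨h w .refl, fun u hu v hv => h v (.head hu hv)⟩, fun ⟨hw, h⟩ u hu => ?_⟩
  rcases hu.cases_head with rfl | ⟨v, hv, hvu⟩
  exacts [hw, h v hv u hvu]

theorem PiLevel.exists_noVar_solution {P V A : Type} [DecidableEq V] {x : V} {n : ℕ}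
    {χ : PDLFormula P V A} (h : PiLevel x n χ) :
    ∃ ψ : PDLFormula P V A, ψ.noVar ∧ ∀ (M : PDLModel P V A) (w : M.W),
      M.Sat ψ w ↔ M.Sat (PDLFormula.subst x ψ χ) w := by
  obtain ⟨ξ, β, hξ, hβ, hs⟩ := h.exists_and_box_normalForm
  exact ⟨.box (.star β) ξ, ⟨hβ, hξ⟩, fun M w => (M.sat_box_star β ξ w).trans (hs _ M w).symm⟩

/-- every fixed-point equation `x ≡ φ(x)` with `φ(x) ∈ Π^x ∪ Σ^x`
(`Σ^x` consisting of the negations `¬̄χ` of formulas `χ ∈ Π^x`) has a solution: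
a formula `ψ` not containing `x` such that `ψ ≡ φ(ψ)` is valid. -/
theorem piSigma_fixedPoint_solution {P V A : Type} [DecidableEq V]
    (x : V) (φ : PDLFormula P V A)
    (h : (∃ n, PiLevel x n φ) ∨ (∃ χ : PDLFormula P V A, (∃ n, PiLevel x n χ) ∧ φ = χ.nneg)) :
    ∃ ψ : PDLFormula P V A, ψ.xFree x ∧
      ∀ (M : PDLModel P V A) (w : M.W),
        M.Sat ψ w ↔ M.Sat (PDLFormula.subst x ψ φ) w := by
  rcases h with ⟨n, h⟩ | ⟨χ, ⟨n, h⟩, rfl⟩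
  · obtain ⟨ψ, hψ, hs⟩ := h.exists_noVar_solution
    exact ⟨ψ, hψ.xFree x, hs⟩
  · obtain ⟨ψ, hψ, hs⟩ := h.exists_noVar_solution
    refine ⟨ψ.nneg, hψ.nneg.xFree x, fun M w => ?_⟩
    rw [h.nneg_subst, M.sat_nneg hψ, M.sat_nneg (h.noVar_subst hψ), hs]
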